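/- Let T = (Q, Σ, δ) be a reversible but not bi-reversible G-automaton. Then there are two distinct letters a, b ∈ Σ such that for all finite words u, v ∈ Σ* the orbits Q*∘(u(av)^ω) and Q*∘(u(bv)^ω) are infinite, where for an ω-word ξ the orbit is Q*∘ξ = {𝐪∘ξ ∣ 𝐪 ∈ Q*}. -/

import Mathlib

/- Common framework for automaton semigroups acting on finite and infinite words.

An S-automaton over states `Q` and alphabet `A` is given by a partial deterministic
transition function `δ : Q → A → Option (A × Q)` (with `δ q a = some (b, p)` encoding
the transition `q –a/b→ p`). -/

namespace AutOrbit

variable {Q A : Type*}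

/-- The partial action `q∘` of a single state on a finite word. -/
def stateAct (δ : Q → A → Option (A × Q)) : Q → List A → Option (List A)
  | _, [] => some []
  | q, a :: u => (δ q a).bind fun bp => (stateAct δ bp.2 u).map fun v => bp.1 :: v

/-- The partial action `𝐪∘` of a state sequence `𝐪 = q_n … q_1` (written left-to-right,
head of the list is `q_n`; the rightmost state `q_1` is applied first). -/
def seqAct (δ : Q → A → Option (A × Q)) (l : List Q) (u : List A) : Option (List A) :=
  l.foldr (fun q acc => acc.bind (stateAct δ q)) (some u)

/-- The length-`n` prefix of an ω-word. -/
def pre (ξ : ℕ → A) (n : ℕ) : List A := List.ofFn fun i : Fin n => ξ i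

/-- The `L`-orbit `L∘u` of a finite word `u`. -/
def orbit (δ : Q → A → Option (A × Q)) (L : Set (List Q)) (u : List A) : Set (List A) :=
  {v | ∃ l ∈ L, seqAct δ l u = some v}

/-- The `L`-orbit `L∘ξ` of an ω-word `ξ`: all ω-words `η` such that some `𝐪 ∈ L` is
defined on `ξ` with `𝐪∘ξ = η` (i.e. `𝐪∘` maps every prefix of `ξ` to the
corresponding prefix of `η`). -/
def omegaOrbit (δ : Q → A → Option (A × Q)) (L : Set (List Q)) (ξ : ℕ → A) :
    Set (ℕ → A) :=
  {η | ∃ l ∈ L, ∀ n, seqAct δ l (pre ξ n) = some (pre η n)}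

/-- The set of partial maps `L∘ = {𝐪∘ ∣ 𝐪 ∈ L}`. -/
def mapsOf (δ : Q → A → Option (A × Q)) (L : Set (List Q)) :
    Set (List A → Option (List A)) :=
  {f | ∃ l ∈ L, f = seqAct δ l}

/-- `L ⊆ F*` is suffix-closed over `F`: every `𝐪 ∈ L` factorizes into factors from `F`
such that every suffix (as a word over the alphabet `F`) of the factorization is
again in `L`. -/
def SuffixClosedOver (F L : Set (List Q)) : Prop :=
  ∀ l ∈ L, ∃ fs : List (List Q),
    (∀ f ∈ fs, f ∈ F) ∧ fs.flatten = l ∧ ∀ i, (fs.drop i).flatten ∈ L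

/-- `L` is finitely suffix-closed: suffix-closed over some finite nonempty `F ⊆ Q*`. -/
def FinitelySuffixClosed (L : Set (List Q)) : Prop :=
  ∃ F : Set (List Q), F.Finite ∧ F.Nonempty ∧ SuffixClosedOver F L

/-- `u` has infinite potential w.r.t. `δ` and `L`: the orbit sizes `|L∘ux|` are unbounded. -/
def InfinitePotential (δ : Q → A → Option (A × Q)) (L : Set (List Q)) (u : List A) : Prop :=
  ∀ C : ℕ, ∃ x : List A, C < (orbit δ L (u ++ x)).ncard

/-- The `i`-th power `𝐪^i` of a state sequence. -/
def listPow (l : List Q) (i : ℕ) : List Q := (List.replicate i l).flatten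

/-- `𝐪∘` has torsion: two distinct positive powers induce the same partial map. -/
def HasTorsion (δ : Q → A → Option (A × Q)) (l : List Q) : Prop :=
  ∃ i j : ℕ, 1 ≤ i ∧ 1 ≤ j ∧ i ≠ j ∧ seqAct δ (listPow l i) = seqAct δ (listPow l j)

/-- The automaton is complete: `δ` is total. -/
def Complete (δ : Q → A → Option (A × Q)) : Prop := ∀ q a, (δ q a).isSome

/-- The automaton is invertible: for every state, the letter-to-output-letter map is a
bijection of the alphabet (each output letter is produced by exactly one input letter). -/
def Invertible (δ : Q → A → Option (A × Q)) : Prop :=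
  ∀ q b, ∃! a, ∃ p, δ q a = some (b, p)

/-- A G-automaton: a complete invertible S-automaton. -/
def GAutomaton (δ : Q → A → Option (A × Q)) : Prop := Complete δ ∧ Invertible δ

/-- Reversibility: for every input letter `a` and target state `p` there is at most one
transition `q –a/b→ p`. -/
def Reversible (δ : Q → A → Option (A × Q)) : Prop :=
  ∀ a p q₁ b₁ q₂ b₂, δ q₁ a = some (b₁, p) → δ q₂ a = some (b₂, p) → q₁ = q₂

/-- Reversibility of the inverse automaton: for every output letter `b` and target
state `p` there is at most one transition `q –a/b→ p`. -/
def InvReversible (δ : Q → A → Option (A × Q)) : Prop :=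
  ∀ b p q₁ a₁ q₂ a₂, δ q₁ a₁ = some (b, p) → δ q₂ a₂ = some (b, p) → q₁ = q₂ ∧ a₁ = a₂

/-- Bi-reversibility: the automaton and its inverse automaton are both reversible. -/
def BiReversible (δ : Q → A → Option (A × Q)) : Prop := Reversible δ ∧ InvReversible δ

/-- The dual automaton `∂T`: states are letters, letters are states; it has a transition
`a –q/p→ b` for every transition `q –a/b→ p` of `T`. -/
def dual (δ : Q → A → Option (A × Q)) : A → Q → Option (Q × A) :=
  fun a q => (δ q a).map fun bp => (bp.2, bp.1)

/-- Adjacency of states in the underlying undirected graph of the automaton. -/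
def Adj (δ : Q → A → Option (A × Q)) (q p : Q) : Prop :=
  (∃ a b, δ q a = some (b, p)) ∨ (∃ a b, δ p a = some (b, q))

/-- `P` is (the state set of) a connected component of the automaton. -/
def IsComponent (δ : Q → A → Option (A × Q)) (P : Set Q) : Prop :=
  ∃ q, P = {p | Relation.ReflTransGen (Adj δ) q p}

/-- The sub-automaton induced on `P` (with all transitions among states of `P`)
is reversible. -/
def SubReversible (δ : Q → A → Option (A × Q)) (P : Set Q) : Prop :=
  ∀ a : A, ∀ p ∈ P, ∀ q₁ b₁ q₂ b₂, q₁ ∈ P → q₂ ∈ P →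
    δ q₁ a = some (b₁, p) → δ q₂ a = some (b₂, p) → q₁ = q₂

/-- The inverse of the sub-automaton induced on `P` is reversible. -/
def SubInvReversible (δ : Q → A → Option (A × Q)) (P : Set Q) : Prop :=
  ∀ b : A, ∀ p ∈ P, ∀ q₁ a₁ q₂ a₂, q₁ ∈ P → q₂ ∈ P →
    δ q₁ a₁ = some (b, p) → δ q₂ a₂ = some (b, p) → q₁ = q₂ ∧ a₁ = a₂

/-- The sub-automaton induced on `P` is bi-reversible. -/
def SubBiReversible (δ : Q → A → Option (A × Q)) (P : Set Q) : Prop :=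
  SubReversible δ P ∧ SubInvReversible δ P

/-- For a complete automaton, the (total) action of a state on a finite word. -/
noncomputable def totAct (δ : Q → A → Option (A × Q)) (q : Q) (u : List A) : List A :=
  (stateAct δ q u).getD u

/-- The action of a state of the automaton (`Sum.inl`) or of its inverse automaton
(`Sum.inr`): for a G-automaton, `totAct δ q` is a bijection of `Σ*` and the inverse
state `q̄` acts as its inverse bijection. -/
noncomputable def gAct (δ : Q → A → Option (A × Q)) : Q ⊕ Q → List A → List A
  | Sum.inl q => totAct δ q
  | Sum.inr q => Function.invFun (totAct δ q)

/-- Action of a sequence over `Q ⊔ Q̄` (rightmost entry applied first). -/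
noncomputable def gSeqAct (δ : Q → A → Option (A × Q)) (l : List (Q ⊕ Q)) (u : List A) :
    List A :=
  l.foldr (fun s v => gAct δ s v) u

/-- The automaton group `G(T) = {𝐪∘ ∣ 𝐪 ∈ (Q ⊔ Q̄)⁺}` as a set of maps on `Σ*`. -/
def autGroup (δ : Q → A → Option (A × Q)) : Set (List A → List A) :=
  {f | ∃ l : List (Q ⊕ Q), l ≠ [] ∧ f = gSeqAct δ l}

/-- The ultimately periodic ω-word `u (a v)^ω`. -/
def ultPer (u : List A) (a : A) (v : List A) (n : ℕ) : A :=
  if h : n < u.length then u.get ⟨n, h⟩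
  else (a :: v).get ⟨(n - u.length) % (a :: v).length, Nat.mod_lt _ (by simp)⟩

/-- Run of a single state on a word, returning the output word and the final state. -/
def runState (δ : Q → A → Option (A × Q)) : Q → List A → Option (List A × Q)
  | q, [] => some ([], q)
  | q, a :: u => (δ q a).bind fun bp =>
      (runState δ bp.2 u).map fun vr => (bp.1 :: vr.1, vr.2)

/-- Run of a state sequence `𝐪` on a word `u`, returning the output word `𝐪∘u` and the
residual state sequence `𝐪·u` (the dual action). -/
def runSeq (δ : Q → A → Option (A × Q)) : List Q → List A → Option (List A × List Q)
  | [], u => some (u, [])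
  | q :: l, u => (runSeq δ l u).bind fun vr =>
      (runState δ q vr.1).map fun wp => (wp.1, wp.2 :: vr.2)

/-- Nodes of the `L`-orbital transducer over `F` of `u`: words reached from `u` along a
path of `F`-labeled edges whose reverse label (a word over `F`) lies in `L`. -/
def transNodes (δ : Q → A → Option (A × Q)) (F L : Set (List Q)) (u : List A) :
    Set (List A) :=
  {v | ∃ fs : List (List Q), (∀ f ∈ fs, f ∈ F) ∧ fs.flatten ∈ L ∧
        ∃ r, runSeq δ fs.flatten u = some (v, r)}

/-- Edges of the `L`-orbital transducer over `F` of `u`: an edge `v –𝐩/𝐨→ w` with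
`𝐩 ∈ F`, input label `𝐩`, output label `𝐨 = 𝐩·v`, lying on a path from `u` whose
reverse label is in `L`. -/
def transEdge (δ : Q → A → Option (A × Q)) (F L : Set (List Q)) (u : List A)
    (v : List A) (p o : List Q) (w : List A) : Prop :=
  p ∈ F ∧ ∃ fs : List (List Q), (∀ f ∈ fs, f ∈ F) ∧ (p :: fs).flatten ∈ L ∧
    (∃ r, runSeq δ fs.flatten u = some (v, r)) ∧ runSeq δ p v = some (w, o)

/-- Isomorphism of the `L`-orbital transducers over `F` of `u₁` and `u₂`: a bijection of
the node sets mapping `u₁` to `u₂` and preserving labeled edges in both directions. -/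
def TransducerIso (δ : Q → A → Option (A × Q)) (F L : Set (List Q)) (u₁ u₂ : List A) :
    Prop :=
  ∃ φ : List A → List A,
    Set.BijOn φ (transNodes δ F L u₁) (transNodes δ F L u₂) ∧ φ u₁ = u₂ ∧
    ∀ v ∈ transNodes δ F L u₁, ∀ w ∈ transNodes δ F L u₁, ∀ p o : List Q,
      (transEdge δ F L u₁ v p o w ↔ transEdge δ F L u₂ (φ v) p o (φ w))


/-- The action of a state of a complete automaton on an ω-word. -/
def omegaAct (d : Q → A → A × Q) : Q → (ℕ → A) → ℕ → A
  | q, ξ, 0 => (d q (ξ 0)).1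
  | q, ξ, n + 1 => omegaAct d (d q (ξ 0)).2 (fun i => ξ (i + 1)) n

/-- The action of a state sequence of a complete automaton on an ω-word. -/
def omegaSeqAct (d : Q → A → A × Q) (l : List Q) (ξ : ℕ → A) : ℕ → A :=
  l.foldr (omegaAct d) ξ

/-- The ω-word without its first `k` letters. -/
def drop (k : ℕ) (ξ : ℕ → A) : ℕ → A := fun n => ξ (n + k)

theorem drop_drop_one (k : ℕ) (ξ : ℕ → A) : drop k (drop 1 ξ) = drop (k + 1) ξ := rfl

theorem pre_succ (ξ : ℕ → A) (n : ℕ) : pre ξ (n + 1) = ξ 0 :: pre (drop 1 ξ) n := by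
  simp [pre, drop, List.ofFn_succ]

theorem pre_injective {ξ η : ℕ → A} (h : ∀ n, pre ξ n = pre η n) : ξ = η := by
  funext n
  exact congrFun (List.ofFn_injective (h (n + 1))) (Fin.last n)

theorem drop_one_omegaAct (d : Q → A → A × Q) (q : Q) (ξ : ℕ → A) :
    drop 1 (omegaAct d q ξ) = omegaAct d (d q (ξ 0)).2 (drop 1 ξ) := rfl

theorem stateAct_pre {δ : Q → A → Option (A × Q)} {d : Q → A → A × Q}
    (hd : ∀ q a, δ q a = some (d q a)) (n : ℕ) (q : Q) (ξ : ℕ → A) :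
    stateAct δ q (pre ξ n) = some (pre (omegaAct d q ξ) n) := by
  induction n generalizing q ξ with
  | zero => simp [pre, stateAct]
  | succ n ih =>
    rw [pre_succ, pre_succ, drop_one_omegaAct]
    simp [stateAct, hd, ih, omegaAct]

theorem seqAct_pre {δ : Q → A → Option (A × Q)} {d : Q → A → A × Q}
    (hd : ∀ q a, δ q a = some (d q a)) (l : List Q) (ξ : ℕ → A) (n : ℕ) :
    seqAct δ l (pre ξ n) = some (pre (omegaSeqAct d l ξ) n) := by
  induction l with
  | nil => rfl
  | cons q l ih =>
    change (seqAct δ l (pre ξ n)).bind (stateAct δ q) = _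
    rw [ih]
    exact stateAct_pre hd n q _

theorem omegaOrbit_univ {δ : Q → A → Option (A × Q)} {d : Q → A → A × Q}
    (hd : ∀ q a, δ q a = some (d q a)) (ξ : ℕ → A) :
    omegaOrbit δ Set.univ ξ = Set.range fun l => omegaSeqAct d l ξ := by
  ext η
  simp only [omegaOrbit, Set.mem_univ, true_and, Set.mem_ofPred_eq, Set.mem_range,
    seqAct_pre hd, Option.some.injEq]
  exact exists_congr fun l => ⟨pre_injective, fun h n => by rw [h]⟩

theorem omegaAct_injective {d : Q → A → A × Q}
    (hinv : ∀ q, Function.Injective fun a => (d q a).1) (q : Q) :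
    Function.Injective (omegaAct d q) := by
  intro ξ η h
  funext n
  induction n generalizing q ξ η with
  | zero => exact hinv q (congrFun h 0)
  | succ n ih =>
    have h0 : ξ 0 = η 0 := hinv q (congrFun h 0)
    have h1 := congrArg (drop 1) h
    rw [drop_one_omegaAct, drop_one_omegaAct, h0] at h1
    exact ih _ h1

theorem exists_drop_omegaSeqAct {d : Q → A → A × Q}
    (hrev : ∀ a, Function.Surjective fun q => (d q a).2) (k : ℕ) (l : List Q) (ξ : ℕ → A) :
    ∃ r, drop k (omegaSeqAct d r ξ) = omegaSeqAct d l (drop k ξ) := by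
  have one (l : List Q) (ξ : ℕ → A) :
      ∃ r, drop 1 (omegaSeqAct d r ξ) = omegaSeqAct d l (drop 1 ξ) := by
    induction l with
    | nil => exact ⟨[], rfl⟩
    | cons q l ih =>
      obtain ⟨r, hr⟩ := ih
      obtain ⟨p, hp⟩ := hrev (omegaSeqAct d r ξ 0) q
      refine ⟨p :: r, ?_⟩
      change drop 1 (omegaAct d p (omegaSeqAct d r ξ)) = omegaAct d q (omegaSeqAct d l _)
      rw [drop_one_omegaAct, hr]
      exact congrArg (fun p => omegaAct d p _) hp
  induction k generalizing l ξ with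
  | zero => exact ⟨l, rfl⟩
  | succ k ih =>
    obtain ⟨s, hs⟩ := ih l (drop 1 ξ)
    obtain ⟨r, hr⟩ := one s ξ
    exact ⟨r, by rw [← drop_drop_one, hr, hs, drop_drop_one]⟩

theorem drop_length_ultPer (u : List A) (a : A) (v : List A) :
    drop u.length (ultPer u a v) = ultPer [] a v := by
  funext n
  simp [drop, ultPer]

theorem drop_period_ultPer (a : A) (v : List A) :
    drop (v.length + 1) (ultPer [] a v) = ultPer [] a v := by
  funext n
  simp [drop, ultPer]

/-- If an ω-word is periodic and two transitions with the same output letter and the same target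
state have distinct input letters, one of which is the first letter of the word, then its orbit
is infinite. -/
theorem infinite_orbit_of_periodic {d : Q → A → A × Q}
    (hinv : ∀ q, Function.Injective fun a => (d q a).1)
    (hrev : ∀ a, Function.Surjective fun q => (d q a).2)
    {q₁ q₂ : Q} {a₁ a₂ : A} (h : d q₁ a₁ = d q₂ a₂) (hne : a₁ ≠ a₂)
    {ξ : ℕ → A} (h0 : ξ 0 = a₁) {k : ℕ} (hk : drop (k + 1) ξ = ξ) :
    (Set.range fun l => omegaSeqAct d l ξ).Infinite := by
  intro hfin
  set S := Set.range fun l => omegaSeqAct d l ξ with hS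
  have hmaps (q : Q) : Set.MapsTo (omegaAct d q) S S := by
    rintro _ ⟨l, rfl⟩
    exact ⟨q :: l, rfl⟩
  have hsub : S ⊆ drop (k + 1) '' S := by
    rintro _ ⟨l, rfl⟩
    obtain ⟨r, hr⟩ := exists_drop_omegaSeqAct hrev (k + 1) l ξ
    rw [hk] at hr
    exact ⟨_, ⟨r, rfl⟩, hr⟩
  have hinj : Set.InjOn (drop (k + 1)) S := by
    apply Set.injOn_of_ncard_image_eq _ hfin
    exact le_antisymm (Set.ncard_image_le hfin) (Set.ncard_le_ncard hsub (hfin.image _))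
  have hξ : ξ ∈ S := ⟨[], rfl⟩
  have hsurj : omegaAct d q₂ '' S = S :=
    Set.eq_of_subset_of_ncard_le (hmaps q₂).image_subset
      (Set.ncard_image_of_injective S (omegaAct_injective hinv q₂)).ge hfin
  obtain ⟨η, hη, hηξ⟩ := hsurj.symm ▸ hmaps q₁ hξ
  have hη0 : η 0 = a₂ := by
    apply hinv q₂
    change (d q₂ (η 0)).1 = (d q₂ a₂).1
    rw [← h, ← h0]
    exact congrFun hηξ 0
  have htail : drop 1 η = drop 1 ξ := by
    have h1 := congrArg (drop 1) hηξ
    rw [drop_one_omegaAct, drop_one_omegaAct, hη0, h0, h] at h1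
    exact omegaAct_injective hinv _ h1
  have : η = ξ := hinj hη hξ (congrArg (drop k) htail)
  exact hne (by rw [← h0, ← hη0, this])

theorem infinite_orbit_ultPer {d : Q → A → A × Q}
    (hinv : ∀ q, Function.Injective fun a => (d q a).1)
    (hrev : ∀ a, Function.Surjective fun q => (d q a).2)
    {q₁ q₂ : Q} {a₁ a₂ : A} (h : d q₁ a₁ = d q₂ a₂) (hne : a₁ ≠ a₂) (u v : List A) :
    (Set.range fun l => omegaSeqAct d l (ultPer u a₁ v)).Infinite := by
  intro hfin
  refine infinite_orbit_of_periodic hinv hrev h hne (ξ := ultPer [] a₁ v) (by simp [ultPer])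
    (drop_period_ultPer a₁ v) ((hfin.image (drop u.length)).subset ?_)
  rintro _ ⟨l, rfl⟩
  obtain ⟨r, hr⟩ := exists_drop_omegaSeqAct hrev u.length l (ultPer u a₁ v)
  rw [drop_length_ultPer] at hr
  exact ⟨_, ⟨r, rfl⟩, hr⟩

/-- Let `T` be a reversible but not bi-reversible G-automaton. Then
there are two distinct letters `a, b ∈ Σ` such that for all `u, v ∈ Σ*` the orbits
`Q*∘(u(av)^ω)` and `Q*∘(u(bv)^ω)` are infinite. -/
theorem periodic_infinite_orbits_of_reversible_not_bireversible {Q A : Type*} [Fintype Q]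
    [Fintype A] [Nonempty A] (δ : Q → A → Option (A × Q)) (hG : GAutomaton δ)
    (hRev : Reversible δ) (hnBi : ¬ BiReversible δ) :
    ∃ a b : A, a ≠ b ∧ ∀ u v : List A,
      (omegaOrbit δ (Set.univ : Set (List Q)) (ultPer u a v)).Infinite ∧
      (omegaOrbit δ (Set.univ : Set (List Q)) (ultPer u b v)).Infinite := by
  have hd : ∃ d : Q → A → A × Q, ∀ q a, δ q a = some (d q a) :=
    ⟨fun q a => (δ q a).get (hG.1 q a), fun q a => (Option.some_get _).symm⟩
  obtain ⟨d, hd⟩ := hd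
  have hinv (q : Q) : Function.Injective fun a => (d q a).1 := by
    intro a b (hab : (d q a).1 = (d q b).1)
    obtain ⟨c, -, hc⟩ := hG.2 q (d q b).1
    rw [hc a ⟨(d q a).2, by rw [hd, ← hab]⟩, hc b ⟨(d q b).2, hd q b⟩]
  have hrev_inj (a : A) : Function.Injective fun q => (d q a).2 := by
    intro p q (hpq : (d p a).2 = (d q a).2)
    refine hRev a (d q a).2 p (d p a).1 q (d q a).1 ?_ (hd q a)
    rw [hd, ← hpq]
  have hrev (a : A) : Function.Surjective fun q => (d q a).2 :=
    Finite.surjective_of_injective (hrev_inj a)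
  have hnInv : ¬ InvReversible δ := fun h => hnBi ⟨hRev, h⟩
  simp only [InvReversible, hd, Option.some.injEq] at hnInv
  push Not at hnInv
  obtain ⟨c, p, q₁, a₁, q₂, a₂, h₁, h₂, hne⟩ := hnInv
  have h : d q₁ a₁ = d q₂ a₂ := h₁.trans h₂.symm
  have ha : a₁ ≠ a₂ := by
    rintro rfl
    exact hne (hrev_inj a₁ (congrArg Prod.snd h)) rfl
  refine ⟨a₁, a₂, ha, fun u v => ?_⟩
  rw [omegaOrbit_univ hd, omegaOrbit_univ hd]
  exact ⟨infinite_orbit_ultPer hinv hrev h ha u v,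
    infinite_orbit_ultPer hinv hrev h.symm ha.symm u v⟩

end AutOrbit
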